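/- Let k be a positive integer with k ≡ 2 (mod 4). Then the restriction map π_{1+i} : J_{k,1}(O_K) → J_{k,2} is the zero map: for every φ ∈ J_{k,1}(O_K), φ(τ,(1+i)z,(1-i)z) = 0 identically. -/

import Mathlib

noncomputable section

open Complex

/-- `τ` lies in the upper half plane. -/
def UHP (τ : ℂ) : Prop := 0 < τ.im

/-- `eC w = exp(2 π i w)`. -/
def eC (w : ℂ) : ℂ := Complex.exp (2 * (Real.pi : ℂ) * Complex.I * w)

/-- Entries of a matrix in `SL(2, ℤ)`, as complex numbers. -/
def Ma (M : Matrix.SpecialLinearGroup (Fin 2) ℤ) : ℂ := ((M.1 0 0 : ℤ) : ℂ)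
def Mb (M : Matrix.SpecialLinearGroup (Fin 2) ℤ) : ℂ := ((M.1 0 1 : ℤ) : ℂ)
def Mc (M : Matrix.SpecialLinearGroup (Fin 2) ℤ) : ℂ := ((M.1 1 0 : ℤ) : ℂ)
def Md (M : Matrix.SpecialLinearGroup (Fin 2) ℤ) : ℂ := ((M.1 1 1 : ℤ) : ℂ)

/-- Hermitian Jacobi form of weight `k` and index `m` for the Hermitian Jacobi group over
`ℤ[i]`.  A form is a function `φ : ℂ → ℂ → ℂ → ℂ`, all conditions being imposed for `τ`
in the upper half plane.  Units `ε ∈ ℤ[i]ˣ = {1, -1, i, -i}`, and the elliptic variables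
`λ = p + q i`, `μ = u + v i` range over `ℤ[i]`.  The Fourier expansion is indexed by
`n ∈ ℕ` and `r = (a + b i)/2 ∈ O_K^♯ = (i/2)ℤ[i]`, supported on `N(r) ≤ n m`,
i.e. `a² + b² ≤ 4 n m`. -/
structure IsHJF (k m : ℕ) (φ : ℂ → ℂ → ℂ → ℂ) : Prop where
  holo : DifferentiableOn ℂ (fun p : ℂ × ℂ × ℂ => φ p.1 p.2.1 p.2.2) {p | UHP p.1}
  transf : ∀ ε : ℂ, ε ∈ ({1, -1, Complex.I, -Complex.I} : Set ℂ) →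
    ∀ M : Matrix.SpecialLinearGroup (Fin 2) ℤ, ∀ τ z₁ z₂ : ℂ, UHP τ →
      φ ((Ma M * τ + Mb M) / (Mc M * τ + Md M))
        (ε * z₁ / (Mc M * τ + Md M))
        ((starRingEnd ℂ) ε * z₂ / (Mc M * τ + Md M))
      = ε ^ k * (Mc M * τ + Md M) ^ k *
          eC ((m : ℂ) * Mc M * z₁ * z₂ / (Mc M * τ + Md M)) * φ τ z₁ z₂
  ellip : ∀ p q u v : ℤ, ∀ τ z₁ z₂ : ℂ, UHP τ →
      φ τ (z₁ + ((p : ℂ) + (q : ℂ) * Complex.I) * τ + ((u : ℂ) + (v : ℂ) * Complex.I))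
          (z₂ + ((p : ℂ) - (q : ℂ) * Complex.I) * τ + ((u : ℂ) - (v : ℂ) * Complex.I))
      = eC (-(m : ℂ) * (((p : ℂ) ^ 2 + (q : ℂ) ^ 2) * τ
          + ((p : ℂ) - (q : ℂ) * Complex.I) * z₁
          + ((p : ℂ) + (q : ℂ) * Complex.I) * z₂)) * φ τ z₁ z₂
  fourier : ∃ c : ℕ → ℤ → ℤ → ℂ,
      (∀ (n : ℕ) (a b : ℤ), 4 * (n : ℤ) * m < a ^ 2 + b ^ 2 → c n a b = 0) ∧
      ∀ τ z₁ z₂ : ℂ, UHP τ →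
        HasSum (fun p : ℕ × ℤ × ℤ => c p.1 p.2.1 p.2.2 *
          eC ((p.1 : ℂ) * τ + (((p.2.1 : ℂ) + (p.2.2 : ℂ) * Complex.I) / 2) * z₁
            + (((p.2.1 : ℂ) - (p.2.2 : ℂ) * Complex.I) / 2) * z₂)) (φ τ z₁ z₂)

/-- Classical Jacobi form of weight `k` and index `m` for `SL(2,ℤ) ⋉ ℤ²`. -/
structure IsJF (k m : ℕ) (φ : ℂ → ℂ → ℂ) : Prop where
  holo : DifferentiableOn ℂ (fun p : ℂ × ℂ => φ p.1 p.2) {p | UHP p.1}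
  transf : ∀ M : Matrix.SpecialLinearGroup (Fin 2) ℤ, ∀ τ z : ℂ, UHP τ →
      φ ((Ma M * τ + Mb M) / (Mc M * τ + Md M)) (z / (Mc M * τ + Md M))
      = (Mc M * τ + Md M) ^ k *
          eC ((m : ℂ) * Mc M * z ^ 2 / (Mc M * τ + Md M)) * φ τ z
  ellip : ∀ p q : ℤ, ∀ τ z : ℂ, UHP τ →
      φ τ (z + (p : ℂ) * τ + (q : ℂ))
      = eC (-(m : ℂ) * ((p : ℂ) ^ 2 * τ + 2 * (p : ℂ) * z)) * φ τ z
  fourier : ∃ c : ℕ → ℤ → ℂ,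
      (∀ (n : ℕ) (r : ℤ), 4 * (n : ℤ) * m < r ^ 2 → c n r = 0) ∧
      ∀ τ z : ℂ, UHP τ →
        HasSum (fun p : ℕ × ℤ => c p.1 p.2 * eC ((p.1 : ℂ) * τ + (p.2 : ℂ) * z)) (φ τ z)

/-- Modular form of weight `k` for `SL(2,ℤ)`. -/
structure IsMF (k : ℕ) (f : ℂ → ℂ) : Prop where
  holo : DifferentiableOn ℂ f {τ | UHP τ}
  transf : ∀ M : Matrix.SpecialLinearGroup (Fin 2) ℤ, ∀ τ : ℂ, UHP τ →
      f ((Ma M * τ + Mb M) / (Mc M * τ + Md M)) = (Mc M * τ + Md M) ^ k * f τ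
  bounded : ∃ A B : ℝ, ∀ τ : ℂ, B ≤ τ.im → ‖f τ‖ ≤ A

/-- Cusp form of weight `k` for `SL(2,ℤ)`. -/
structure IsCF (k : ℕ) (f : ℂ → ℂ) : Prop where
  holo : DifferentiableOn ℂ f {τ | UHP τ}
  transf : ∀ M : Matrix.SpecialLinearGroup (Fin 2) ℤ, ∀ τ : ℂ, UHP τ →
      f ((Ma M * τ + Mb M) / (Mc M * τ + Md M)) = (Mc M * τ + Md M) ^ k * f τ
  decay : ∀ ε : ℝ, 0 < ε → ∃ B : ℝ, ∀ τ : ℂ, B ≤ τ.im → ‖f τ‖ ≤ ε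

/-- `M_w(SL(2,ℤ), ω̄)` for the character `ω` of `SL(2,ℤ)` with `ω(T) = ω(S) = i`:
holomorphic functions on the upper half plane, bounded at infinity, with
`f|_w T = -i f` and `f|_w S = -i f`. -/
structure IsMFOmegaBar (w : ℕ) (f : ℂ → ℂ) : Prop where
  holo : DifferentiableOn ℂ f {τ | UHP τ}
  transT : ∀ τ : ℂ, UHP τ → f (τ + 1) = -Complex.I * f τ
  transS : ∀ τ : ℂ, UHP τ → f (-1 / τ) = -Complex.I * τ ^ w * f τ
  bounded : ∃ A B : ℝ, ∀ τ : ℂ, B ≤ τ.im → ‖f τ‖ ≤ A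

/-- Hermitian theta function `θ^H_{m,s}` of index `m` with characteristic
`s = (a + b i)/2 ∈ O_K^♯`; the sum is over `r = s + m (g₁ + g₂ i) ∈ s + m ℤ[i]`. -/
def thetaH (m : ℕ) (a b : ℤ) (τ z₁ z₂ : ℂ) : ℂ :=
  ∑' g : ℤ × ℤ,
    eC ((((a : ℂ) + 2 * m * g.1) ^ 2 + ((b : ℂ) + 2 * m * g.2) ^ 2) / (4 * m) * τ
      + (((a : ℂ) + 2 * m * g.1) + ((b : ℂ) + 2 * m * g.2) * Complex.I) / 2 * z₁
      + (((a : ℂ) + 2 * m * g.1) - ((b : ℂ) + 2 * m * g.2) * Complex.I) / 2 * z₂)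

/-- Classical theta function `θ_{m,μ}(τ,z) = Σ_{r ≡ μ mod 2m} e(r²τ/(4m) + r z)`. -/
def thetaJ (m : ℕ) (μ : ℤ) (τ z : ℂ) : ℂ :=
  ∑' g : ℤ, eC (((μ : ℂ) + 2 * m * g) ^ 2 / (4 * m) * τ + ((μ : ℂ) + 2 * m * g) * z)

/-- `h` is the family of theta components of `φ` (for index `m`): the `h_{a,b}` depend
only on `(a, b) mod 2m` and `φ = Σ_{s ∈ O_K^♯ / m O_K} h_s θ^H_{m,s}`. -/
def HasThetaDecomp (m : ℕ) (φ : ℂ → ℂ → ℂ → ℂ) (h : ℤ → ℤ → ℂ → ℂ) : Prop :=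
  (∀ (a b : ℤ) (τ : ℂ), h (a + 2 * m) b τ = h a b τ ∧ h a (b + 2 * m) τ = h a b τ) ∧
  ∀ τ z₁ z₂ : ℂ, UHP τ →
    φ τ z₁ z₂ = ∑ a ∈ Finset.range (2 * m), ∑ b ∈ Finset.range (2 * m),
      h (a : ℤ) (b : ℤ) τ * thetaH m (a : ℤ) (b : ℤ) τ z₁ z₂

/-- `ϑ₀(τ) = Σ_{r ∈ ℤ} e(r² τ)`. -/
def theta0C (τ : ℂ) : ℂ := ∑' r : ℤ, eC ((r : ℂ) ^ 2 * τ)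

/-- `ϑ₁(τ) = Σ_{r odd} e(r² τ / 4)`. -/
def theta1C (τ : ℂ) : ℂ := ∑' r : ℤ, eC ((2 * (r : ℂ) + 1) ^ 2 * τ / 4)

/-- `ξ = ϑ₁ ϑ₀' − ϑ₀ ϑ₁'`. -/
def xiC (τ : ℂ) : ℂ := theta1C τ * deriv theta0C τ - theta0C τ * deriv theta1C τ

/-- Taylor coefficient `χ_{α,β}(τ)` of `φ(τ, z₁, z₂)` around `z₁ = z₂ = 0`. -/
def chiHJF (φ : ℂ → ℂ → ℂ → ℂ) (α β : ℕ) (τ : ℂ) : ℂ :=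
  (1 / ((α.factorial : ℂ) * (β.factorial : ℂ))) *
    iteratedDeriv α (fun z₁ => iteratedDeriv β (fun z₂ => φ τ z₁ z₂) 0) 0

/-- `D₀ : J_{k,m} → M_k`, `ψ ↦ ψ(·, 0)`. -/
def D0J (ψ : ℂ → ℂ → ℂ) : ℂ → ℂ := fun τ => ψ τ 0

/-- `D₂ : J_{k,m} → S_{k+2}`, `D₂ψ = (2k/(2πi)²) ψ₂ − (2m/(2πi)) ψ₀'`, where `ψ_ν` are
the Taylor coefficients of `ψ` around `z = 0`. -/
def D2J (k m : ℕ) (ψ : ℂ → ℂ → ℂ) : ℂ → ℂ := fun τ =>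
  (2 * (k : ℂ) / (2 * (Real.pi : ℂ) * Complex.I) ^ 2) *
      ((1 / 2) * iteratedDeriv 2 (fun z => ψ τ z) 0)
    - (2 * (m : ℂ) / (2 * (Real.pi : ℂ) * Complex.I)) * deriv (fun t => ψ t 0) τ

/-- Normalized Eisenstein series `E₄`. -/
def E4C (τ : ℂ) : ℂ :=
  1 + 240 * ∑' n : ℕ, ((ArithmeticFunction.sigma 3) n : ℂ) * eC ((n : ℂ) * τ)

/-- Normalized Eisenstein series `E₆`. -/
def E6C (τ : ℂ) : ℂ :=
  1 - 504 * ∑' n : ℕ, ((ArithmeticFunction.sigma 5) n : ℂ) * eC ((n : ℂ) * τ)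

/-- `f` agrees on the upper half plane with a polynomial in `E₄` and `E₆²` that is
homogeneous of weight `k - v`, i.e. supported on `4a + 12b + v = k`. -/
def IsE4E6sqPoly (v k : ℕ) (f : ℂ → ℂ) : Prop :=
  ∃ lam : ℕ × ℕ → ℂ, ∀ τ : ℂ, UHP τ →
    f τ = ∑ p ∈ (Finset.range (k + 1) ×ˢ Finset.range (k + 1)).filter
        (fun p => 4 * p.1 + 12 * p.2 + v = k),
      lam p * E4C τ ^ p.1 * E6C τ ^ (2 * p.2)

/-- The slash action `φ|_{k,m} M` of `M ∈ SL(2,ℤ)` on functions `ℂ → ℂ → ℂ → ℂ`. -/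
def slashHJF (k m : ℕ) (φ : ℂ → ℂ → ℂ → ℂ) (M : Matrix.SpecialLinearGroup (Fin 2) ℤ)
    (τ z₁ z₂ : ℂ) : ℂ :=
  ((Mc M * τ + Md M) ^ k)⁻¹ *
    eC (-(m : ℂ) * Mc M * z₁ * z₂ / (Mc M * τ + Md M)) *
    φ ((Ma M * τ + Mb M) / (Mc M * τ + Md M)) (z₁ / (Mc M * τ + Md M)) (z₂ / (Mc M * τ + Md M))

/-- Hermitian Jacobi form of weight `k` and index `m` for the congruence subgroup `Γ₀(N)`,
with at each cusp a Fourier expansion supported on `(n, r) ∈ ℚ_{≥0} × O_K^♯`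
with `N(r) ≤ n m`. -/
structure IsHJFLevel (k m N : ℕ) (φ : ℂ → ℂ → ℂ → ℂ) : Prop where
  holo : DifferentiableOn ℂ (fun p : ℂ × ℂ × ℂ => φ p.1 p.2.1 p.2.2) {p | UHP p.1}
  transf : ∀ ε : ℂ, ε ∈ ({1, -1, Complex.I, -Complex.I} : Set ℂ) →
    ∀ M : Matrix.SpecialLinearGroup (Fin 2) ℤ, (N : ℤ) ∣ M.1 1 0 →
    ∀ τ z₁ z₂ : ℂ, UHP τ →
      φ ((Ma M * τ + Mb M) / (Mc M * τ + Md M))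
        (ε * z₁ / (Mc M * τ + Md M))
        ((starRingEnd ℂ) ε * z₂ / (Mc M * τ + Md M))
      = ε ^ k * (Mc M * τ + Md M) ^ k *
          eC ((m : ℂ) * Mc M * z₁ * z₂ / (Mc M * τ + Md M)) * φ τ z₁ z₂
  ellip : ∀ p q u v : ℤ, ∀ τ z₁ z₂ : ℂ, UHP τ →
      φ τ (z₁ + ((p : ℂ) + (q : ℂ) * Complex.I) * τ + ((u : ℂ) + (v : ℂ) * Complex.I))
          (z₂ + ((p : ℂ) - (q : ℂ) * Complex.I) * τ + ((u : ℂ) - (v : ℂ) * Complex.I))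
      = eC (-(m : ℂ) * (((p : ℂ) ^ 2 + (q : ℂ) ^ 2) * τ
          + ((p : ℂ) - (q : ℂ) * Complex.I) * z₁
          + ((p : ℂ) + (q : ℂ) * Complex.I) * z₂)) * φ τ z₁ z₂
  cusp : ∀ M : Matrix.SpecialLinearGroup (Fin 2) ℤ,
      ∃ c : ℚ → ℤ → ℤ → ℂ,
        (∀ (n : ℚ) (a b : ℤ),
          ¬ (0 ≤ n ∧ ((a : ℚ) ^ 2 + (b : ℚ) ^ 2) ≤ 4 * n * m) → c n a b = 0) ∧
        ∀ τ z₁ z₂ : ℂ, UHP τ →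
          HasSum (fun p : ℚ × ℤ × ℤ => c p.1 p.2.1 p.2.2 *
            eC ((p.1 : ℂ) * τ + (((p.2.1 : ℂ) + (p.2.2 : ℂ) * Complex.I) / 2) * z₁
              + (((p.2.1 : ℂ) - (p.2.2 : ℂ) * Complex.I) / 2) * z₂))
            (slashHJF k m φ M τ z₁ z₂)

/-- Theta constant `x`. -/
def thConstX (τ : ℂ) : ℂ := ∑' n : ℤ, eC ((n : ℂ) ^ 2 * τ / 2)

/-- Theta constant `y`. -/
def thConstY (τ : ℂ) : ℂ := ∑' n : ℤ, (-1 : ℂ) ^ n * eC ((n : ℂ) ^ 2 * τ / 2)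

/-- Theta constant `z`. -/
def thConstZ (τ : ℂ) : ℂ := ∑' n : ℤ, eC (((n : ℂ) + 1 / 2) ^ 2 * τ / 2)


lemma eC_add (a b : ℂ) : eC (a + b) = eC a * eC b := by
  unfold eC; rw [← Complex.exp_add]; congr 1; ring

lemma eC_zero : eC 0 = 1 := by simp [eC]

lemma eC_ne (a : ℂ) : eC a ≠ 0 := Complex.exp_ne_zero _

lemma fourier_unique (D : ℤ → ℂ) (hD : Summable D)
    (h : ∀ y : ℝ, HasSum (fun b : ℤ => D b * eC ((b : ℂ) * y)) 0) (m : ℤ) : D m = 0 := by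
  haveI : Fact ((0 : ℝ) < 1) := ⟨one_pos⟩
  have hs : Summable (fun b : ℤ => D b • (fourier b : C(AddCircle (1 : ℝ), ℂ))) := by
    apply Summable.of_norm
    simpa [norm_smul, fourier_norm] using hD.norm
  have ht : ∑' b : ℤ, D b • (fourier b : C(AddCircle (1 : ℝ), ℂ)) = 0 := by
    ext y
    induction y using QuotientAddGroup.induction_on with
    | H y =>
      have h1 := (hs.hasSum.mapL (ContinuousMap.evalCLM ℂ (y : AddCircle (1:ℝ))))
      refine h1.unique ?_
      have hf : (fun b : ℤ => (ContinuousMap.evalCLM ℂ (y : AddCircle (1:ℝ)))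
          (D b • (fourier b : C(AddCircle (1 : ℝ), ℂ)))) =
          fun b : ℤ => D b * eC ((b : ℂ) * y) := by
        funext b
        simp only [map_smul, ContinuousMap.evalCLM_apply, fourier_coe_apply, eC, smul_eq_mul]
        congr 2
        push_cast
        ring
      rw [hf]
      exact h y
  have h0 := hs.hasSum
  rw [ht] at h0
  have h1 := h0.mapL (ContinuousMap.toLp (E := ℂ) 2 (AddCircle.haarAddCircle (T := (1:ℝ))) ℂ)
  have h2 := h1.mapL (innerSL ℂ (fourierLp (T := (1:ℝ)) 2 m))
  have ho := orthonormal_iff_ite.mp (orthonormal_fourier (T := (1:ℝ))) m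
  have h3 : HasSum (fun b : ℤ => if b = m then D m else 0) 0 := by
    rw [map_zero, map_zero] at h2
    have hf : ∀ b : ℤ, (innerSL ℂ (fourierLp (T := (1:ℝ)) 2 m))
        (ContinuousMap.toLp (E := ℂ) 2 (AddCircle.haarAddCircle (T := (1:ℝ))) ℂ
          (D b • (fourier b : C(AddCircle (1 : ℝ), ℂ)))) = if b = m then D m else 0 := by
      intro b
      have hb := ho b
      rw [map_smul, map_smul, innerSL_apply_apply]
      change D b • inner ℂ (fourierLp (T := (1:ℝ)) 2 m) (fourierLp (T := (1:ℝ)) 2 b) = _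
      rw [hb]
      by_cases hbm : b = m
      · subst hbm; simp
      · simp [hbm, Ne.symm hbm]
    simpa only [hf] using h2
  exact (hasSum_ite_eq m (D m)).unique h3

lemma even_y (k : ℕ) (φ : ℂ → ℂ → ℂ → ℂ) (hφ : IsHJF k 1 φ) (τ x y : ℂ) (hτ : UHP τ) :
    φ τ (x + I * -y) (x - I * -y) = φ τ (x + I * y) (x - I * y) := by
  obtain ⟨c, -, hc⟩ := hφ.fourier
  set A : ℤ → ℂ := fun b => ∑' p : ℕ × ℤ, c p.1 p.2 b * eC ((p.1 : ℂ) * τ + (p.2 : ℂ) * x) with hA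
  have key : ∀ y : ℂ, HasSum (fun b : ℤ => A b * eC (-(b : ℂ) * y))
      (φ τ (x + I * y) (x - I * y)) := by
    intro y
    let e : ℤ × (ℕ × ℤ) ≃ ℕ × ℤ × ℤ :=
      (Equiv.prodComm _ _).trans (Equiv.prodAssoc _ _ _)
    have h1 := (e.hasSum_iff).mpr (hc τ (x + I * y) (x - I * y) hτ)
    have h2 : HasSum (fun q : ℤ × (ℕ × ℤ) =>
        (c q.2.1 q.2.2 q.1 * eC ((q.2.1 : ℂ) * τ + (q.2.2 : ℂ) * x)) * eC (-(q.1 : ℂ) * y))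
        (φ τ (x + I * y) (x - I * y)) := by
      convert h1 using 2 with q
      obtain ⟨b, n, a⟩ := q
      simp only [e, Function.comp, Equiv.trans_apply, Equiv.prodComm_apply, Prod.swap,
        Equiv.prodAssoc_apply]
      rw [mul_assoc, ← eC_add]
      congr 2
      linear_combination (-(b:ℂ) * y) * Complex.I_sq
    have h3 := h2.prod_fiberwise (fun b => (h2.summable.prod_factor b).hasSum)
    convert h3 using 2 with b
    exact tsum_mul_right.symm
  have hrec0 : ∀ b : ℤ, A b * eC (-(b:ℂ) * τ) - A (b - 2) * eC (-τ) = 0 := by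
    have hs1 : ∀ y : ℂ, HasSum
        (fun b : ℤ => (A b * eC (-(b:ℂ) * τ) - A (b - 2) * eC (-τ)) * eC (-(b:ℂ) * y)) 0 := by
      intro y
      have h1 := key (y + τ)
      have h2 := (key y).mul_left (eC (-(τ + 2 * y)))
      rw [← (Equiv.subRight (2:ℤ)).hasSum_iff] at h2
      have h4 := hφ.ellip 0 1 0 0 τ (x + I * y) (x - I * y) hτ
      have h5 : φ τ (x + I * (y + τ)) (x - I * (y + τ))
          = eC (-(τ + 2 * y)) * φ τ (x + I * y) (x - I * y) := by
        convert h4 using 2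
        · push_cast; ring
        · push_cast; ring
        · congr 1; push_cast; linear_combination (-2 * y) * Complex.I_sq
      rw [h5] at h1
      have h6 := h1.sub h2
      rw [sub_self] at h6
      refine (congrArg (fun f => HasSum f (0:ℂ)) (funext fun b => ?_)).mpr h6
      change _ = A b * eC (-(b:ℂ) * (y + τ)) -
        eC (-(τ + 2 * y)) * (A (b - 2) * eC (-((b - 2 : ℤ):ℂ) * y))
      have e1 : eC (-(b:ℂ) * (y + τ)) = eC (-(b:ℂ) * τ) * eC (-(b:ℂ) * y) := by
        rw [← eC_add]; congr 1; ring
      have e2 : eC (-τ) * eC (-(b:ℂ) * y) = eC (-(τ + 2 * y)) * eC (-((b - 2 : ℤ):ℂ) * y) := by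
        rw [← eC_add, ← eC_add]; congr 1; push_cast; ring
      rw [e1]
      linear_combination (-A (b-2)) * e2
    intro b
    refine fourier_unique (fun b : ℤ => A b * eC (-(b:ℂ) * τ) - A (b - 2) * eC (-τ)) ?_ ?_ b
    · simpa [eC_zero] using (hs1 0).summable
    · intro y
      simpa using hs1 (-(y:ℂ))
  have hrec : ∀ b : ℤ, A b = A (b - 2) * eC (((b:ℂ) - 1) * τ) := by
    intro b
    have h := hrec0 b
    have e1 : eC (-(b:ℂ) * τ) * eC ((b:ℂ) * τ) = 1 := by
      rw [← eC_add, ← eC_zero]; congr 1; ring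
    have e2 : eC (((b:ℂ) - 1) * τ) = eC (-τ) * eC ((b:ℂ) * τ) := by
      rw [← eC_add]; congr 1; ring
    rw [e2]
    linear_combination (eC ((b:ℂ) * τ)) * h - A b * e1
  have hstep : ∀ n : ℤ, A n = A (-n) → A (n + 2) = A (-(n + 2)) := by
    intro n hn
    have h1 := hrec (n + 2)
    have h2 := hrec (-n)
    rw [show n + 2 - 2 = n by ring] at h1
    rw [show -n - 2 = -(n+2) by ring] at h2
    rw [h1, hn, h2, mul_assoc, ← eC_add]
    rw [show ((-n : ℤ) - 1 : ℂ) * τ + (((n + 2 : ℤ) : ℂ) - 1) * τ = 0 by push_cast; ring]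
    rw [eC_zero, mul_one]
  have hnat : ∀ n : ℕ, A n = A (-n) ∧ A (n + 1) = A (-(n + 1)) := by
    intro n
    induction n with
    | zero =>
      refine ⟨by simp, ?_⟩
      have := hrec 1
      norm_num [eC_zero] at this ⊢
      exact this
    | succ n ih =>
      refine ⟨by push_cast; exact ih.2, ?_⟩
      have := hstep n ih.1
      push_cast
      rw [show (n:ℤ) + 1 + 1 = n + 2 by ring]
      exact this
  have heven : ∀ b : ℤ, A (-b) = A b := by
    intro b
    obtain ⟨n, rfl | rfl⟩ := b.eq_nat_or_neg
    · exact (hnat n).1.symm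
    · rw [neg_neg]; exact (hnat n).1
  have h1 := key (-y)
  rw [← (Equiv.neg ℤ).hasSum_iff] at h1
  refine h1.unique ?_
  convert key y using 2 with b
  simp [heven]

/-- for `k ≡ 2 (mod 4)` the restriction map
`π_{1+i} : J_{k,1}(O_K) → J_{k,2}` is the zero map. -/
theorem stmt1 (k : ℕ) (hk : 0 < k) (hk4 : k % 4 = 2)
    (φ : ℂ → ℂ → ℂ → ℂ) (hφ : IsHJF k 1 φ) :
    ∀ τ z : ℂ, UHP τ → φ τ ((1 + Complex.I) * z) ((1 - Complex.I) * z) = 0 := by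
  intro τ z hτ
  obtain ⟨j, rfl⟩ : ∃ j, k = 4 * j + 2 := ⟨k / 4, by omega⟩
  have h1 := hφ.transf I (by simp) 1 τ ((1 + I) * z) ((1 - I) * z) hτ
  have h2 := hφ.transf (-1) (by simp) 1 τ ((1 + I) * z) ((1 - I) * z) hτ
  have h3 := even_y _ φ hφ τ (-z) z hτ
  have hI : I ^ (4 * j + 2) = -1 := by rw [pow_add, pow_mul, I_pow_four]; simp
  have hm : (-1 : ℂ) ^ (4 * j + 2) = 1 := by
    rw [show 4 * j + 2 = 2 * (2 * j + 1) by ring, pow_mul]; simp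
  rw [hI] at h1
  rw [hm] at h2
  simp only [Ma, Mb, Mc, Md, Matrix.SpecialLinearGroup.coe_one, Matrix.one_apply_eq, ne_eq,
    one_ne_zero, zero_ne_one, not_false_eq_true, Matrix.one_apply_ne, Int.cast_one, Int.cast_zero,
    map_neg, map_one, Complex.conj_I, one_mul, zero_mul, mul_zero, zero_add, add_zero, div_one,
    one_pow, mul_one, zero_div, eC_zero] at h1 h2
  rw [show I * ((1 + I) * z) = -z + I * z by linear_combination z * I_sq,
    show -I * ((1 - I) * z) = -z - I * z by linear_combination z * I_sq] at h1
  rw [show -1 * ((1 + I) * z) = -z + I * -z by ring,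
    show -1 * ((1 - I) * z) = -z - I * -z by ring] at h2
  linear_combination (1/2) * h1 - (1/2) * h2 + (1/2) * h3
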